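/- For every v ∈ 𝒮(ℝ;ℂ): ‖A_Q v‖²_{L²} + ‖|D|^{1/2}(Q·v)‖²_{L²} = ‖∂ₓv‖²_{L²} + ¼·‖Q²·v‖²_{L²}, where ‖|D|^{1/2}g‖²_{L²} = (|D|g, g)_r. Moreover, there exists a universal constant C > 0 such that for every v ∈ 𝒮(ℝ;ℂ): C⁻¹·‖v‖_{𝓗̇¹} ≤ ‖A_Q v‖_{L²} + ‖|D|^{1/2}(Q·v)‖_{L²} ≤ C·‖v‖_{𝓗̇¹}. -/

import Mathlib

open MeasureTheory Filter Topology

/-- The Hilbert transform, realized as a principal-value integral: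
`Hf(x) = (1/π) p.v. ∫ f(y)/(x-y) dy`. -/
noncomputable def pvH (f : ℝ → ℂ) (x : ℝ) : ℂ :=
  limUnder (nhdsWithin (0 : ℝ) (Set.Ioi 0)) fun ε : ℝ =>
    (Real.pi : ℂ)⁻¹ * ∫ y in {y : ℝ | ε < |x - y|}, f y / ((x - y : ℝ) : ℂ)

/-- The soliton `Q(x) = √2/√(1+x²)` (real-valued). -/
noncomputable def Qr (x : ℝ) : ℝ := Real.sqrt 2 / Real.sqrt (1 + x ^ 2)

/-- The soliton, viewed as a complex-valued function. -/
noncomputable def Qc (x : ℝ) : ℂ := (Qr x : ℂ)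

/-- `B_Q f = x⟨x⟩⁻¹ f − H(⟨x⟩⁻¹ f)`. -/
noncomputable def BQ (f : ℝ → ℂ) : ℝ → ℂ := fun x =>
  ((x / Real.sqrt (1 + x ^ 2) : ℝ) : ℂ) * f x
    - pvH (fun y => (((Real.sqrt (1 + y ^ 2))⁻¹ : ℝ) : ℂ) * f y) x

/-- `A_Q f = ∂ₓ(x⟨x⟩⁻¹ f − H(⟨x⟩⁻¹ f)) = ∂ₓ(B_Q f)`. -/
noncomputable def AQ (f : ℝ → ℂ) : ℝ → ℂ := deriv (BQ f)

/-- `‖|D|^{1/2} g‖²_{L²} = (|D|g, g)_r = Re ∫ H(∂ₓg)·conj(g)`, the half-derivative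
square norm. -/
noncomputable def halfDsq (g : ℝ → ℂ) : ℝ :=
  (∫ x : ℝ, pvH (deriv g) x * (starRingEnd ℂ) (g x)).re

/-- The `𝓗̇¹` norm (for smooth functions):
`‖v‖²_{𝓗̇¹} = ∫|∂ₓv|² + ∫|⟨x⟩⁻¹v|²`. -/
noncomputable def H1normS (v : ℝ → ℂ) : ℝ :=
  Real.sqrt ((∫ x : ℝ, ‖deriv v x‖ ^ 2)
    + ∫ x : ℝ, ‖(((Real.sqrt (1 + x ^ 2))⁻¹ : ℝ) : ℂ) * v x‖ ^ 2)

open SchwartzMap FourierTransform ComplexConjugate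

/-- The Hilbert transform written as an absolutely convergent integral. -/
noncomputable def hilbert (f : ℝ → ℂ) (x : ℝ) : ℂ :=
  (Real.pi : ℂ)⁻¹ * ∫ t in Set.Ioi (0 : ℝ), ((t⁻¹ : ℝ) : ℂ) * (f (x - t) - f (x + t))

lemma integral_eq_integral_Ioi_add_neg {h : ℝ → ℂ} (hh : Integrable h) :
    ∫ t, h t = ∫ t in Set.Ioi (0 : ℝ), (h t + h (-t)) := by
  rw [integral_add hh.integrableOn hh.comp_neg.integrableOn, integral_comp_neg_Ioi, neg_zero,
    add_comm, intervalIntegral.integral_Iic_add_Ioi hh.integrableOn hh.integrableOn]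

lemma SchwartzMap.exists_bound (f : 𝓢(ℝ, ℂ)) : ∃ M : ℝ, 0 ≤ M ∧ ∀ x, ‖f x‖ ≤ M := by
  obtain ⟨M, hM, h⟩ := f.decay 0 0
  exact ⟨M, hM.le, fun x => by simpa using h x⟩

lemma integrableOn_hilbert_kernel (f : 𝓢(ℝ, ℂ)) (x : ℝ) :
    IntegrableOn (fun t : ℝ => ((t⁻¹ : ℝ) : ℂ) * (f (x - t) - f (x + t))) (Set.Ioi 0) := by
  have hm : AEStronglyMeasurable
      (fun t : ℝ => ((t⁻¹ : ℝ) : ℂ) * (f (x - t) - f (x + t))) volume := by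
    have hf := f.continuous
    refine AEStronglyMeasurable.mul ?_ ?_
    · exact (by fun_prop : Measurable fun t : ℝ => ((t⁻¹ : ℝ) : ℂ)).aestronglyMeasurable
    · exact (by fun_prop : Continuous fun t : ℝ => f (x - t) - f (x + t)).aestronglyMeasurable
  have hu : Set.Ioi (0 : ℝ) = Set.Ioc 0 1 ∪ Set.Ioi 1 :=
    (Set.Ioc_union_Ioi_eq_Ioi zero_le_one).symm
  rw [hu]
  refine IntegrableOn.union ?_ ?_
  · obtain ⟨M, hM, hb⟩ := SchwartzMap.exists_bound (derivCLM ℂ ℂ f)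
    refine Measure.integrableOn_of_bounded (M := 2 * M) (by simp) hm ?_
    refine (ae_restrict_iff' measurableSet_Ioc).2 (ae_of_all _ fun t ht => ?_)
    have h1 : ‖f (x - t) - f (x + t)‖ ≤ M * ‖(x - t) - (x + t)‖ :=
      Convex.norm_image_sub_le_of_norm_deriv_le (s := Set.univ)
        (fun y _ => f.differentiableAt) (fun y _ => hb y) convex_univ
        (Set.mem_univ _) (Set.mem_univ _)
    have h2 : ‖(x - t) - (x + t)‖ = 2 * t := by
      rw [show (x - t) - (x + t) = -(2 * t) by ring, norm_neg, Real.norm_of_nonneg]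
      linarith [ht.1]
    rw [norm_mul, Complex.norm_real, Real.norm_of_nonneg (inv_nonneg.2 ht.1.le),
      inv_mul_le_iff₀ ht.1]
    rw [h2] at h1
    linarith
  · have hi : Integrable (fun t : ℝ => ‖f (x - t) - f (x + t)‖) :=
      ((f.integrable.comp_sub_left x).sub (f.integrable.comp_add_left x)).norm
    refine Integrable.mono' hi.integrableOn hm.restrict ?_
    refine (ae_restrict_iff' measurableSet_Ioi).2 (ae_of_all _ fun t ht => ?_)
    have ht' : (1 : ℝ) < t := ht
    rw [norm_mul, Complex.norm_real, Real.norm_of_nonneg (by positivity)]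
    exact mul_le_of_le_one_left (norm_nonneg _) (inv_le_one_of_one_le₀ ht'.le)

/-- Regularizations of the kernel `1/t` by bounded odd kernels recover the Hilbert transform. -/
lemma tendsto_integral_odd_kernel {l : Filter ℝ} [l.IsCountablyGenerated]
    (f : 𝓢(ℝ, ℂ)) (x : ℝ) (K : ℝ → ℝ → ℝ)
    (hodd : ∀ i t, K i (-t) = -K i t) (hmeas : ∀ i, Measurable (K i))
    (hbdd : ∀ᶠ i in l, ∃ C, ∀ t, |K i t| ≤ C) (hle : ∀ i t, 0 < t → |K i t| ≤ t⁻¹)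
    (hlim : ∀ t, 0 < t → Tendsto (fun i => K i t) l (𝓝 t⁻¹)) :
    Tendsto (fun i => (Real.pi : ℂ)⁻¹ * ∫ y, (K i (x - y) : ℂ) * f y) l (𝓝 (hilbert f x)) := by
  have hf := f.continuous
  have hfold : ∀ᶠ i in l, ∫ t in Set.Ioi (0 : ℝ), (K i t : ℂ) * (f (x - t) - f (x + t))
      = ∫ y, (K i (x - y) : ℂ) * f y := by
    filter_upwards [hbdd] with i ⟨C, hC⟩
    have hK_int : Integrable (fun t : ℝ => (K i t : ℂ) * f (x - t)) := by
      refine (f.integrable.comp_sub_left x).bdd_mul (c := C) ?_ (ae_of_all _ fun t => ?_)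
      · exact (Complex.measurable_ofReal.comp (hmeas i)).aestronglyMeasurable
      · simpa using hC t
    calc _ = ∫ t in Set.Ioi (0 : ℝ),
          ((K i t : ℂ) * f (x - t) + (K i (-t) : ℂ) * f (x - -t)) := by
          congr 1
          ext t
          rw [hodd, sub_neg_eq_add]
          push_cast
          ring
      _ = ∫ t, (K i t : ℂ) * f (x - t) := (integral_eq_integral_Ioi_add_neg hK_int).symm
      _ = ∫ y, (K i (x - y) : ℂ) * f (x - (x - y)) :=
          (integral_sub_left_eq_self (fun t : ℝ => (K i t : ℂ) * f (x - t)) volume x).symm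
      _ = _ := by simp
  refine Tendsto.const_mul _ (Tendsto.congr' hfold ?_)
  refine tendsto_integral_filter_of_dominated_convergence
    (fun t => ‖((t⁻¹ : ℝ) : ℂ) * (f (x - t) - f (x + t))‖) (Eventually.of_forall fun i => ?_)
    (Eventually.of_forall fun i => ?_) (integrableOn_hilbert_kernel f x).norm ?_
  · exact ((Complex.measurable_ofReal.comp (hmeas i)).aestronglyMeasurable.mul
      (by fun_prop : Continuous fun t : ℝ => f (x - t) - f (x + t)).aestronglyMeasurable)
  · refine (ae_restrict_iff' measurableSet_Ioi).2 (ae_of_all _ fun t ht => ?_)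
    have ht' : (0 : ℝ) < t := ht
    rw [norm_mul, norm_mul, Complex.norm_real, Complex.norm_real,
      Real.norm_of_nonneg (inv_nonneg.2 ht'.le)]
    exact mul_le_mul_of_nonneg_right (hle i t ht) (norm_nonneg _)
  · refine (ae_restrict_iff' measurableSet_Ioi).2 (ae_of_all _ fun t ht => ?_)
    exact ((Complex.continuous_ofReal.tendsto _).comp (hlim t ht)).mul_const _

lemma pvH_eq_hilbert (f : 𝓢(ℝ, ℂ)) (x : ℝ) : pvH f x = hilbert f x := by
  refine Tendsto.limUnder_eq ?_
  have key := tendsto_integral_odd_kernel (l := 𝓝[>] (0 : ℝ)) f x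
    (fun ε => {t : ℝ | ε < |t|}.indicator fun t => t⁻¹) ?_ ?_ ?_ ?_ ?_
  · refine key.congr fun ε => ?_
    congr 1
    rw [← integral_indicator (measurableSet_lt measurable_const (by fun_prop))]
    congr 1
    ext y
    by_cases h : ε < |x - y|
    · simp only [Set.indicator, Set.mem_ofPred_eq, h, if_true]
      push_cast
      rw [div_eq_inv_mul]
    · simp [Set.indicator, h]
  · intro ε t
    by_cases h : ε < |t| <;> simp [Set.indicator, h, inv_neg]
  · intro ε
    exact measurable_inv.indicator (measurableSet_lt measurable_const (by fun_prop))
  · filter_upwards [self_mem_nhdsWithin] with ε hε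
    have hε : 0 < ε := hε
    refine ⟨ε⁻¹, fun t => ?_⟩
    by_cases h : ε < |t|
    · simp only [Set.indicator, Set.mem_ofPred_eq, h, if_true, abs_inv]
      exact inv_anti₀ hε h.le
    · simp [Set.indicator, h, hε.le]
  · intro ε t ht
    by_cases h : ε < t <;> simp [Set.indicator, h, abs_of_pos ht, ht.le]
  · intro t ht
    refine tendsto_const_nhds.congr' ?_
    filter_upwards [nhdsWithin_le_nhds (Iio_mem_nhds ht)] with ε hε
    have : ε < |t| := by rw [abs_of_pos ht]; exact hε
    simp [Set.indicator, this]

lemma mul_hilbert (f h : 𝓢(ℝ, ℂ)) (hh : ∀ y, h y = y * f y) (x : ℝ) :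
    x * hilbert f x = hilbert h x + (Real.pi : ℂ)⁻¹ * ∫ y, f y := by
  have hf : Integrable fun t => f (x - t) := f.integrable.comp_sub_left x
  have h1 : ∫ y, f y = ∫ t in Set.Ioi (0 : ℝ), (f (x - t) + f (x + t)) := by
    rw [← integral_sub_left_eq_self f volume x, integral_eq_integral_Ioi_add_neg hf]
    simp
  have h2 : IntegrableOn (fun t => f (x - t) + f (x + t)) (Set.Ioi 0) :=
    (hf.add (f.integrable.comp_add_left x)).integrableOn
  rw [h1, hilbert, hilbert, ← mul_add, ← integral_add (integrableOn_hilbert_kernel h x) h2,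
    mul_left_comm, ← integral_const_mul]
  congr 1
  refine setIntegral_congr_fun measurableSet_Ioi fun t ht => ?_
  have ht' : (t : ℂ) ≠ 0 := by exact_mod_cast (ne_of_gt ht)
  simp only [hh]
  push_cast
  field_simp
  ring

/-- The Fourier symbol `-i sgn ξ` of the Hilbert transform. -/
noncomputable def hilbertSymbol (ξ : ℝ) : ℂ := if 0 < ξ then -Complex.I else Complex.I

lemma norm_hilbertSymbol (ξ : ℝ) : ‖hilbertSymbol ξ‖ = 1 := by
  unfold hilbertSymbol
  split_ifs <;> simp

lemma measurable_hilbertSymbol : Measurable hilbertSymbol :=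
  Measurable.ite measurableSet_Ioi measurable_const measurable_const

lemma conj_hilbertSymbol (ξ : ℝ) : conj (hilbertSymbol ξ) = -hilbertSymbol ξ := by
  unfold hilbertSymbol
  split_ifs <;> simp

lemma integrable_hilbertSymbol_mul {g : ℝ → ℂ} (hg : Integrable g) :
    Integrable fun ξ => hilbertSymbol ξ * g ξ :=
  hg.bdd_mul (c := 1) measurable_hilbertSymbol.aestronglyMeasurable
    (ae_of_all _ fun ξ => (norm_hilbertSymbol ξ).le)

lemma integral_fourier_mul_eq_flip {f g : ℝ → ℂ} (hf : Integrable f) (hg : Integrable g) :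
    ∫ ξ, 𝓕 f ξ * g ξ = ∫ x, f x * 𝓕 g x := by
  simpa using! VectorFourier.integral_fourierIntegral_smul_eq_flip (L := innerₗ ℝ)
    Real.continuous_fourierChar continuous_inner hf hg

lemma integrable_exp_neg_mul_abs {ε : ℝ} (hε : 0 < ε) :
    Integrable fun ξ : ℝ => (Real.exp (-ε * |ξ|) : ℂ) := by
  refine Integrable.ofReal (f := fun ξ : ℝ => Real.exp (-ε * |ξ|)) ?_
  have h1 : IntegrableOn (fun ξ : ℝ => Real.exp (-ε * |ξ|)) (Set.Ioi 0) :=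
    (integrableOn_exp_mul_Ioi (neg_lt_zero.2 hε) 0).congr_fun
      (fun ξ hξ => by simp only [abs_of_pos (Set.mem_Ioi.1 hξ)]) measurableSet_Ioi
  have h2 : IntegrableOn (fun ξ : ℝ => Real.exp (-ε * |ξ|)) (Set.Iic 0) :=
    (integrableOn_exp_mul_Iic hε 0).congr_fun
      (fun ξ hξ => by simp only [abs_of_nonpos (Set.mem_Iic.1 hξ), neg_mul_neg]) measurableSet_Iic
  rw [← integrableOn_univ, ← Set.Iic_union_Ioi (a := (0 : ℝ))]
  exact h2.union h1

lemma integral_hilbertSymbol_exp {δ : ℝ} (hδ : 0 < δ) (t : ℝ) :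
    ∫ ξ : ℝ, Complex.exp (2 * Real.pi * Complex.I * t * ξ) *
      (hilbertSymbol ξ * (Real.exp (-(2 * Real.pi * δ) * |ξ|) : ℂ))
      = (Real.pi : ℂ)⁻¹ * ((t / (t ^ 2 + δ ^ 2) : ℝ) : ℂ) := by
  have hexp_int : Integrable fun ξ : ℝ => Complex.exp (2 * Real.pi * Complex.I * t * ξ) *
      (hilbertSymbol ξ * (Real.exp (-(2 * Real.pi * δ) * |ξ|) : ℂ)) := by
    refine (integrable_hilbertSymbol_mul
      (integrable_exp_neg_mul_abs (by positivity : 0 < 2 * Real.pi * δ))).bdd_mul (c := 1)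
      (by fun_prop) (ae_of_all _ fun ξ => ?_)
    rw [Complex.norm_exp]
    simp
  have hre1 : (-(2 * Real.pi * (δ - t * Complex.I))).re < 0 := by
    simp; positivity
  have hre2 : (-(2 * Real.pi * (δ + t * Complex.I))).re < 0 := by
    simp; positivity
  have hne1 : (δ - t * Complex.I) ≠ 0 := fun h => hδ.ne' (by simpa using congrArg Complex.re h)
  have hne2 : (δ + t * Complex.I) ≠ 0 := fun h => hδ.ne' (by simpa using congrArg Complex.re h)
  rw [integral_eq_integral_Ioi_add_neg hexp_int]
  calc _ = ∫ ξ in Set.Ioi (0 : ℝ),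
        (-Complex.I * Complex.exp (-(2 * Real.pi * (δ - t * Complex.I)) * ξ)
          + Complex.I * Complex.exp (-(2 * Real.pi * (δ + t * Complex.I)) * ξ)) := by
        refine setIntegral_congr_fun measurableSet_Ioi fun ξ hξ => ?_
        have hξ : 0 < ξ := hξ
        simp only [hilbertSymbol, hξ, if_true, neg_pos, hξ.not_gt, if_false, abs_neg,
          abs_of_pos hξ, Complex.ofReal_exp]
        rw [mul_left_comm, ← Complex.exp_add, mul_left_comm, ← Complex.exp_add]
        congr 3 <;> push_cast <;> ring
    _ = -Complex.I * (-Complex.exp (-(2 * Real.pi * (δ - t * Complex.I)) * (0 : ℝ))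
            / (-(2 * Real.pi * (δ - t * Complex.I))))
          + Complex.I * (-Complex.exp (-(2 * Real.pi * (δ + t * Complex.I)) * (0 : ℝ))
            / (-(2 * Real.pi * (δ + t * Complex.I)))) := by
        rw [integral_add ((integrableOn_exp_mul_complex_Ioi hre1 0).const_mul _)
          ((integrableOn_exp_mul_complex_Ioi hre2 0).const_mul _), integral_const_mul,
          integral_const_mul, integral_exp_mul_complex_Ioi hre1, integral_exp_mul_complex_Ioi hre2]
    _ = _ := by
        have hpi : (Real.pi : ℂ) ≠ 0 := by exact_mod_cast Real.pi_ne_zero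
        have hprod : ((t : ℂ) ^ 2 + δ ^ 2) = (δ - t * Complex.I) * (δ + t * Complex.I) := by
          linear_combination (t : ℂ) ^ 2 * Complex.I_sq
        push_cast
        rw [hprod]
        simp only [mul_zero, Complex.exp_zero]
        have hab : Complex.I * ((δ - t * Complex.I) - (δ + t * Complex.I)) = 2 * t := by
          linear_combination (-2 * t : ℂ) * Complex.I_sq
        generalize (δ - t * Complex.I) = a at *
        generalize (δ + t * Complex.I) = b at *
        field_simp
        linear_combination hab

lemma integral_poisson_kernel_mul (f : 𝓢(ℝ, ℂ)) (x : ℝ) {δ : ℝ} (hδ : 0 < δ) :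
    (Real.pi : ℂ)⁻¹ * ∫ y, (((x - y) / ((x - y) ^ 2 + δ ^ 2) : ℝ) : ℂ) * f y
      = ∫ ξ, 𝓕 (f : ℝ → ℂ) ξ * (Complex.exp (2 * Real.pi * Complex.I * x * ξ) *
        (hilbertSymbol ξ * (Real.exp (-(2 * Real.pi * δ) * |ξ|) : ℂ))) := by
  have hexp_int : Integrable fun ξ : ℝ => Complex.exp (2 * Real.pi * Complex.I * x * ξ) *
      (hilbertSymbol ξ * (Real.exp (-(2 * Real.pi * δ) * |ξ|) : ℂ)) := by
    refine (integrable_hilbertSymbol_mul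
      (integrable_exp_neg_mul_abs (by positivity : 0 < 2 * Real.pi * δ))).bdd_mul (c := 1)
      (by fun_prop) (ae_of_all _ fun ξ => ?_)
    rw [Complex.norm_exp]
    simp
  rw [integral_fourier_mul_eq_flip f.integrable hexp_int, ← integral_const_mul]
  congr 1
  ext y
  rw [← mul_assoc, ← integral_hilbertSymbol_exp hδ, mul_comm, Real.fourier_real_eq_integral_exp_smul]
  congr 2
  ext ξ
  rw [smul_eq_mul, ← mul_assoc (Complex.exp _) (Complex.exp _), ← Complex.exp_add]
  congr 2
  push_cast
  ring

lemma hilbert_eq_integral (f : 𝓢(ℝ, ℂ)) (x : ℝ) :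
    hilbert f x = ∫ ξ : ℝ, 𝓕 (f : ℝ → ℂ) ξ *
      (Complex.exp (2 * Real.pi * Complex.I * x * ξ) * hilbertSymbol ξ) := by
  have h1 := tendsto_integral_odd_kernel (l := 𝓝[>] (0 : ℝ)) f x
    (fun δ t => t / (t ^ 2 + δ ^ 2)) (fun δ t => by rw [neg_sq, neg_div])
    (fun δ => by fun_prop) ?_ ?_ ?_
  · refine tendsto_nhds_unique h1 (Tendsto.congr' (f₁ := fun δ : ℝ => ∫ ξ : ℝ, 𝓕 (f : ℝ → ℂ) ξ *
      (Complex.exp (2 * Real.pi * Complex.I * x * ξ) *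
        (hilbertSymbol ξ * (Real.exp (-(2 * Real.pi * δ) * |ξ|) : ℂ)))) ?_ ?_)
    · filter_upwards [self_mem_nhdsWithin] with δ hδ
      exact (integral_poisson_kernel_mul f x hδ).symm
    · refine tendsto_integral_filter_of_dominated_convergence (fun ξ => ‖𝓕 (f : ℝ → ℂ) ξ‖)
        (Eventually.of_forall fun δ => ?_) ?_ ((𝓕 f).integrable.norm) ?_
      · refine AEStronglyMeasurable.mul (𝓕 f).continuous.aestronglyMeasurable
          (AEStronglyMeasurable.mul (by fun_prop) (AEStronglyMeasurable.mul
          measurable_hilbertSymbol.aestronglyMeasurable (by fun_prop)))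
      · filter_upwards [self_mem_nhdsWithin] with δ hδ
        have hδ : 0 < δ := hδ
        refine ae_of_all _ fun ξ => ?_
        rw [norm_mul, norm_mul, norm_mul, norm_hilbertSymbol, Complex.norm_exp, Complex.norm_real,
          Real.norm_of_nonneg (Real.exp_pos _).le]
        refine mul_le_of_le_one_right (norm_nonneg _) ?_
        have : Real.exp (-(2 * Real.pi * δ) * |ξ|) ≤ 1 := by
          refine Real.exp_le_one_iff.2 ?_
          have : 0 ≤ 2 * Real.pi * δ * |ξ| := by positivity
          linarith
        simpa using this
      · refine ae_of_all _ fun ξ => ?_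
        refine Tendsto.const_mul _ (Tendsto.const_mul _ ?_)
        have : Continuous fun δ : ℝ =>
            hilbertSymbol ξ * (Real.exp (-(2 * Real.pi * δ) * |ξ|) : ℂ) := by fun_prop
        have := (this.tendsto 0).mono_left (nhdsWithin_le_nhds (s := Set.Ioi 0))
        simpa using this
  · filter_upwards [self_mem_nhdsWithin] with δ hδ
    have hδ : 0 < δ := hδ
    refine ⟨δ⁻¹, fun t => ?_⟩
    rw [abs_div, abs_of_pos (by positivity : 0 < t ^ 2 + δ ^ 2), div_le_iff₀ (by positivity),
      inv_mul_eq_div, le_div_iff₀ hδ]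
    nlinarith [sq_nonneg (|t| - δ), sq_abs t, abs_nonneg t]
  · intro δ t ht
    rw [abs_div, abs_of_pos ht, abs_of_pos (by positivity : 0 < t ^ 2 + δ ^ 2),
      div_le_iff₀ (by positivity), inv_mul_eq_div, le_div_iff₀ ht]
    nlinarith [sq_nonneg δ]
  · intro t ht
    have : ContinuousAt (fun δ : ℝ => t / (t ^ 2 + δ ^ 2)) 0 := by
      refine ContinuousAt.div (by fun_prop) (by fun_prop) (by positivity)
    have := this.tendsto.mono_left (nhdsWithin_le_nhds (s := Set.Ioi 0))
    have e : t / (t ^ 2 + 0 ^ 2) = t⁻¹ := by field_simp; ring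
    rwa [e] at this

lemma hilbert_eq_fourierInv (f : 𝓢(ℝ, ℂ)) :
    hilbert f = 𝓕⁻ (fun ξ => hilbertSymbol ξ * 𝓕 (f : ℝ → ℂ) ξ) := by
  ext x
  rw [hilbert_eq_integral, Real.fourierInv_eq']
  congr 1
  ext ξ
  rw [smul_eq_mul, mul_comm, mul_assoc]
  congr 2
  simp only [RCLike.inner_apply, conj_trivial]
  push_cast
  ring

lemma exists_bound_hilbert (f : 𝓢(ℝ, ℂ)) : ∃ M : ℝ, ∀ x, ‖hilbert f x‖ ≤ M := by
  refine ⟨∫ ξ, ‖𝓕 (f : ℝ → ℂ) ξ‖, fun x => ?_⟩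
  rw [hilbert_eq_integral]
  refine (norm_integral_le_integral_norm _).trans_eq ?_
  congr 1
  ext ξ
  rw [norm_mul, norm_mul, norm_hilbertSymbol, Complex.norm_exp]
  simp

lemma hasDerivAt_hilbert (f : 𝓢(ℝ, ℂ)) (x : ℝ) :
    HasDerivAt (hilbert f) (hilbert (derivCLM ℂ ℂ f) x) x := by
  have hF : ∀ ξ : ℝ, 𝓕 (derivCLM ℂ ℂ f : ℝ → ℂ) ξ
      = (2 * Real.pi * Complex.I * ξ) * 𝓕 (f : ℝ → ℂ) ξ := fun ξ => by
    have := congrFun (Real.fourier_deriv f.integrable f.differentiable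
      (derivCLM ℂ ℂ f).integrable) ξ
    simpa using! this
  have hi : Integrable (fun ξ : ℝ => ξ • (hilbertSymbol ξ * 𝓕 (f : ℝ → ℂ) ξ)) := by
    have h1 : Integrable (𝓕 (derivCLM ℂ ℂ f : ℝ → ℂ)) := (𝓕 (derivCLM ℂ ℂ f)).integrable
    have h2 := (integrable_hilbertSymbol_mul h1).const_mul (2 * Real.pi * Complex.I)⁻¹
    refine h2.congr (ae_of_all _ fun ξ => ?_)
    have hpi : (2 * Real.pi * Complex.I : ℂ) ≠ 0 := Complex.two_pi_I_ne_zero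
    simp only [hF, Complex.real_smul]
    have hpi' : (Real.pi : ℂ) ≠ 0 := by exact_mod_cast Real.pi_ne_zero
    have hI := Complex.I_ne_zero
    field_simp
  have hd := Real.hasDerivAt_fourier
    (integrable_hilbertSymbol_mul (𝓕 f).integrable) hi (-x)
  have hd' := hd.scomp x (hasDerivAt_neg x)
  rw [hilbert_eq_fourierInv, hilbert_eq_fourierInv]
  refine (hd'.congr_deriv ?_).congr_of_eventuallyEq (Eventually.of_forall fun y => ?_)
  · rw [Real.fourierInv_eq_fourier_neg, Real.fourier_eq, Real.fourier_eq, neg_one_smul,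
      ← integral_neg]
    congr 1
    ext ξ
    rw [← smul_neg, hF]
    congr 1
    simp only [smul_eq_mul]
    ring
  · exact Real.fourierInv_eq_fourier_neg _ _

lemma continuous_hilbert (f : 𝓢(ℝ, ℂ)) : Continuous (hilbert f) :=
  continuous_iff_continuousAt.2 fun x => (hasDerivAt_hilbert f x).continuousAt

lemma integral_conj_fourier_mul_eq {f g : ℝ → ℂ} (hf : Integrable f) (hg : Integrable g) :
    ∫ ξ, conj (𝓕 f ξ) * g ξ = ∫ x, conj (f x) * 𝓕⁻ g x := by
  have h : ∫ ξ, g ξ * conj (𝓕 f ξ) = ∫ x, 𝓕⁻ g x * conj (f x) := by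
    simpa using! VectorFourier.integral_sesq_fourierIntegral_eq_neg_flip (innerSL ℂ)
      (L := innerₗ ℝ) Real.continuous_fourierChar continuous_inner hf hg
  simpa only [mul_comm] using h

lemma integral_conj_mul_hilbert (f g : 𝓢(ℝ, ℂ)) :
    ∫ x, conj (g x) * hilbert f x
      = ∫ ξ, conj (𝓕 (g : ℝ → ℂ) ξ) * (hilbertSymbol ξ * 𝓕 (f : ℝ → ℂ) ξ) := by
  rw [hilbert_eq_fourierInv,
    integral_conj_fourier_mul_eq g.integrable (integrable_hilbertSymbol_mul (𝓕 f).integrable)]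

lemma integral_hilbert_mul_conj (f g : 𝓢(ℝ, ℂ)) :
    ∫ x, hilbert f x * conj (g x) = -∫ x, f x * conj (hilbert g x) := by
  have h1 : ∫ x, f x * conj (hilbert g x) = conj (∫ x, conj (f x) * hilbert g x) := by
    rw [← integral_conj]
    simp
  have h2 : ∫ x, hilbert f x * conj (g x) = ∫ x, conj (g x) * hilbert f x := by
    simp_rw [mul_comm]
  rw [h1, h2, integral_conj_mul_hilbert, integral_conj_mul_hilbert, ← integral_conj, ← integral_neg]
  congr 1
  ext ξ
  simp only [map_mul, Complex.conj_conj, conj_hilbertSymbol]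
  ring

lemma exists_schwartz_mul_id (f : 𝓢(ℝ, ℂ)) : ∃ h : 𝓢(ℝ, ℂ), ∀ y, h y = y * f y := by
  refine ⟨smulLeftCLM ℂ (fun y : ℝ => y) f, fun y => ?_⟩
  rw [smulLeftCLM_apply_apply (by fun_prop)]
  simp

lemma integral_deriv_schwartz (f : 𝓢(ℝ, ℂ)) : ∫ x, derivCLM ℂ ℂ f x = 0 :=
  integral_eq_zero_of_hasDerivAt_of_integrable (fun x => f.hasDerivAt x)
    (derivCLM ℂ ℂ f).integrable f.integrable

/-- The Hilbert transform of a mean-zero Schwartz function decays quadratically. -/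
lemma exists_decay_hilbert (f : 𝓢(ℝ, ℂ)) (hf : ∫ x, f x = 0) :
    ∃ M : ℝ, ∀ x, ‖hilbert f x‖ ≤ M * (1 + x ^ 2)⁻¹ := by
  obtain ⟨h, hh⟩ := exists_schwartz_mul_id f
  obtain ⟨k, hk⟩ := exists_schwartz_mul_id h
  obtain ⟨M₀, hM₀⟩ := exists_bound_hilbert f
  obtain ⟨M₁, hM₁⟩ := exists_bound_hilbert k
  refine ⟨M₀ + (M₁ + ‖(Real.pi : ℂ)⁻¹ * ∫ y, h y‖), fun x => ?_⟩
  have h1 : (x : ℂ) ^ 2 * hilbert f x = hilbert k x + (Real.pi : ℂ)⁻¹ * ∫ y, h y := by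
    rw [← mul_hilbert h k hk, sq, mul_assoc, mul_hilbert f h hh, hf]
    simp
  have h2 : x ^ 2 * ‖hilbert f x‖ ≤ M₁ + ‖(Real.pi : ℂ)⁻¹ * ∫ y, h y‖ := by
    calc x ^ 2 * ‖hilbert f x‖ = ‖(x : ℂ) ^ 2 * hilbert f x‖ := by
          rw [norm_mul, norm_pow, Complex.norm_real, Real.norm_eq_abs, sq_abs]
      _ ≤ _ := by
          rw [h1]
          exact (norm_add_le _ _).trans (by gcongr; exact hM₁ x)
  rw [← div_eq_mul_inv, le_div_iff₀ (by positivity)]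
  linarith [hM₀ x]

lemma integrable_hilbert (f : 𝓢(ℝ, ℂ)) (hf : ∫ x, f x = 0) : Integrable (hilbert f) := by
  obtain ⟨M, hM⟩ := exists_decay_hilbert f hf
  exact (integrable_inv_one_add_sq.const_mul M).mono'
    (continuous_hilbert f).aestronglyMeasurable (ae_of_all _ hM)

lemma integrable_norm_sq_hilbert (f : 𝓢(ℝ, ℂ)) (hf : ∫ x, f x = 0) :
    Integrable fun x => ‖hilbert f x‖ ^ 2 := by
  obtain ⟨M, hM⟩ := exists_bound_hilbert f
  simp_rw [sq]
  exact (integrable_hilbert f hf).norm.bdd_mul (c := M)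
    (continuous_hilbert f).norm.aestronglyMeasurable (ae_of_all _ fun x => by simpa using hM x)

/-- The Hilbert transform is an `L²` isometry on mean-zero Schwartz functions. -/
lemma integral_norm_sq_hilbert (f : 𝓢(ℝ, ℂ)) (hf : ∫ x, f x = 0) :
    ∫ x, ‖hilbert f x‖ ^ 2 = ∫ x, ‖f x‖ ^ 2 := by
  have hm := integrable_hilbertSymbol_mul (𝓕 f).integrable
  have hH : hilbert f = 𝓕⁻ fun ξ => hilbertSymbol ξ * 𝓕 f ξ := hilbert_eq_fourierInv f
  have hi := integrable_hilbert f hf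
  have hae : ∀ᵐ ξ : ℝ, 𝓕 (hilbert f) ξ = hilbertSymbol ξ * 𝓕 f ξ := by
    filter_upwards [Measure.ae_ne volume (0 : ℝ)] with ξ hξ
    have hc : ContinuousAt hilbertSymbol ξ := by
      rcases hξ.lt_or_gt with h | h
      · refine (continuousAt_const (y := Complex.I)).congr ?_
        filter_upwards [Iio_mem_nhds h] with η hη
        simp [hilbertSymbol, (Set.mem_Iio.1 hη).le]
      · refine (continuousAt_const (y := -Complex.I)).congr ?_
        filter_upwards [Ioi_mem_nhds h] with η hη
        simp [hilbertSymbol, Set.mem_Ioi.1 hη]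
    rw [hH]
    have hi' : Integrable (𝓕 fun ξ => hilbertSymbol ξ * 𝓕 f ξ) := by
      refine (hi.comp_neg).congr (ae_of_all _ fun y => ?_)
      beta_reduce
      rw [hH, Real.fourierInv_eq_fourier_neg, neg_neg]
    exact hm.fourier_fourierInv_eq hi' (hc.mul (𝓕 f).continuous.continuousAt)
  have key := integral_conj_fourier_mul_eq hi hm
  rw [← hH] at key
  have h1 : ∫ ξ, conj (𝓕 (hilbert f) ξ) * (hilbertSymbol ξ * 𝓕 f ξ)
      = ((∫ ξ, ‖𝓕 f ξ‖ ^ 2 : ℝ) : ℂ) := by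
    rw [← integral_complex_ofReal]
    refine integral_congr_ae ?_
    filter_upwards [hae] with ξ hξ
    rw [hξ, mul_comm, Complex.mul_conj, Complex.normSq_eq_norm_sq, norm_mul, norm_hilbertSymbol,
      one_mul]
  have h2 : ∫ x, conj (hilbert f x) * hilbert f x = ((∫ x, ‖hilbert f x‖ ^ 2 : ℝ) : ℂ) := by
    rw [← integral_complex_ofReal]
    congr 1
    ext x
    rw [mul_comm, Complex.mul_conj, Complex.normSq_eq_norm_sq]
  rw [h1, h2, SchwartzMap.integral_norm_sq_fourier] at key
  exact_mod_cast key.symm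

lemma hilbert_const_mul (c : ℂ) (f : ℝ → ℂ) (x : ℝ) :
    hilbert (fun y => c * f y) x = c * hilbert f x := by
  unfold hilbert
  have h : ∀ t : ℝ, ((t⁻¹ : ℝ) : ℂ) * (c * f (x - t) - c * f (x + t))
      = c * (((t⁻¹ : ℝ) : ℂ) * (f (x - t) - f (x + t))) := fun t => by ring
  simp_rw [h]
  rw [integral_const_mul]
  ring

lemma exists_schwartz_inv_sqrt_mul (v : 𝓢(ℝ, ℂ)) :
    ∃ w : 𝓢(ℝ, ℂ), ∀ y, w y = (((Real.sqrt (1 + y ^ 2))⁻¹ : ℝ) : ℂ) * v y := by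
  refine ⟨smulLeftCLM ℂ (fun y : ℝ => (1 + ‖y‖ ^ 2) ^ (-(1 / 2) : ℝ)) v, fun y => ?_⟩
  rw [smulLeftCLM_apply_apply (Function.hasTemperateGrowth_one_add_norm_sq_rpow ℝ _),
    Real.rpow_neg (by positivity), ← Real.sqrt_eq_rpow, Real.norm_eq_abs, sq_abs]
  simp

lemma SchwartzMap.integrable_norm_sq (f : 𝓢(ℝ, ℂ)) : Integrable fun x => ‖f x‖ ^ 2 :=
  (memLp_two_iff_integrable_sq_norm f.continuous.aestronglyMeasurable).1 (f.memLp 2)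

section Coercivity

variable {w u : 𝓢(ℝ, ℂ)}

lemma deriv_mul_id (hu : ∀ y, u y = y * w y) (x : ℝ) :
    derivCLM ℂ ℂ u x = w x + x * derivCLM ℂ ℂ w x := by
  have h : HasDerivAt u (1 * w x + x * deriv w x) x := by
    have h0 : HasDerivAt (fun y : ℝ => (y : ℂ)) 1 x := Complex.ofRealCLM.hasDerivAt
    exact (h0.mul (w.hasDerivAt x)).congr_of_eventuallyEq (Eventually.of_forall hu)
  rw [derivCLM_apply, derivCLM_apply, h.deriv, one_mul]

/-- The virial identity `Re (x g, H g) = 0`. -/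
lemma re_integral_hilbert_mul_conj_mul_id {g k : 𝓢(ℝ, ℂ)} (hg : ∫ x, g x = 0)
    (hk : ∀ y, k y = y * g y) : (∫ x, hilbert g x * conj (k x)).re = 0 := by
  have h1 : ∀ x, hilbert k x = x * hilbert g x := fun x => by
    rw [mul_hilbert g k hk, hg]
    simp
  have h2 : ∫ x, hilbert g x * conj (k x) = -conj (∫ x, hilbert g x * conj (k x)) := by
    conv_lhs => rw [integral_hilbert_mul_conj]
    rw [← integral_conj]
    congr 2
    ext x
    rw [h1, hk]
    simp only [map_mul, Complex.conj_conj, Complex.conj_ofReal]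
    ring
  have h3 := congrArg Complex.re h2
  simp only [Complex.neg_re, Complex.conj_re] at h3
  linarith

lemma integrable_hilbert_mul_conj (f g : 𝓢(ℝ, ℂ)) :
    Integrable fun x => hilbert f x * conj (g x) := by
  obtain ⟨M, hM⟩ := exists_bound_hilbert f
  have hc : Continuous fun x => conj (g x) := Complex.continuous_conj.comp g.continuous
  refine Integrable.bdd_mul (c := M) ?_ (continuous_hilbert f).aestronglyMeasurable
    (ae_of_all _ hM)
  exact g.integrable.mono hc.aestronglyMeasurable (ae_of_all _ fun x => by simp)

lemma integrable_norm_sq_sub_hilbert (F : 𝓢(ℝ, ℂ)) {g : 𝓢(ℝ, ℂ)} (hg : ∫ x, g x = 0) :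
    Integrable fun x => ‖F x - hilbert g x‖ ^ 2 := by
  have hc := continuous_hilbert g
  have hF := F.continuous
  refine ((F.integrable_norm_sq.const_mul 2).add
    ((integrable_norm_sq_hilbert g hg).const_mul 2)).mono'
    (by fun_prop : Continuous fun x => ‖F x - hilbert g x‖ ^ 2).aestronglyMeasurable
    (ae_of_all _ fun x => ?_)
  rw [Real.norm_of_nonneg (by positivity)]
  have := norm_sub_le (F x) (hilbert g x)
  simp only [Pi.add_apply]
  nlinarith [norm_nonneg (F x - hilbert g x), sq_nonneg (‖F x‖ - ‖hilbert g x‖)]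

lemma integral_norm_sq_sub_hilbert (F : 𝓢(ℝ, ℂ)) {g : 𝓢(ℝ, ℂ)} (hg : ∫ x, g x = 0) :
    ∫ x, ‖F x - hilbert g x‖ ^ 2 = (∫ x, ‖F x‖ ^ 2) + (∫ x, ‖g x‖ ^ 2)
      - 2 * (∫ x, hilbert g x * conj (F x)).re := by
  have hi := integrable_hilbert_mul_conj g F
  have hire : Integrable fun x => (hilbert g x * conj (F x)).re := hi.re
  have hadd : Integrable fun x => ‖F x‖ ^ 2 + ‖hilbert g x‖ ^ 2 :=
    F.integrable_norm_sq.add (integrable_norm_sq_hilbert g hg)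
  have hre : (∫ x, hilbert g x * conj (F x)).re = ∫ x, (hilbert g x * conj (F x)).re :=
    (integral_re hi).symm
  rw [hre, ← integral_norm_sq_hilbert g hg, ← integral_const_mul,
    ← integral_add F.integrable_norm_sq (integrable_norm_sq_hilbert g hg),
    ← integral_sub hadd (hire.const_mul 2)]
  congr 1
  ext x
  simp only [← Complex.normSq_eq_norm_sq, Complex.normSq_apply, Complex.mul_re, Complex.conj_re,
    Complex.conj_im, Complex.sub_re, Complex.sub_im]
  ring

lemma integral_norm_sq_sub_hilbert_le (F : 𝓢(ℝ, ℂ)) {g : 𝓢(ℝ, ℂ)} (hg : ∫ x, g x = 0) :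
    ∫ x, ‖F x - hilbert g x‖ ^ 2 ≤ 2 * ((∫ x, ‖F x‖ ^ 2) + ∫ x, ‖g x‖ ^ 2) := by
  rw [← integral_norm_sq_hilbert g hg,
    ← integral_add F.integrable_norm_sq (integrable_norm_sq_hilbert g hg), ← integral_const_mul]
  refine integral_mono (integrable_norm_sq_sub_hilbert F hg)
    ((F.integrable_norm_sq.add (integrable_norm_sq_hilbert g hg)).const_mul 2) fun x => ?_
  have := norm_sub_le (F x) (hilbert g x)
  simp only
  nlinarith [norm_nonneg (F x - hilbert g x), sq_nonneg (‖F x‖ - ‖hilbert g x‖)]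

/-- Hardy's inequality in the form `‖w‖² ≤ 4 ‖∂ₓ(x w)‖²`. -/
lemma integral_norm_sq_le_of_mul_id (hu : ∀ y, u y = y * w y) :
    ∫ x, ‖w x‖ ^ 2 ≤ 4 * ∫ x, ‖derivCLM ℂ ℂ u x‖ ^ 2 := by
  have hinner : ∀ a b : 𝓢(ℝ, ℂ), Integrable fun x => inner ℝ (a x) (b x) := fun a b =>
    (pairing (innerSL ℝ) a b).integrable
  have hibp : ∫ x, inner ℝ (u x) (derivCLM ℂ ℂ w x)
      = -∫ x, inner ℝ (derivCLM ℂ ℂ u x) (w x) :=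
    SchwartzMap.integral_bilinear_deriv_right_eq_neg_left u w (innerSL ℝ)
  have hz : ∫ x, (inner ℝ (u x) (derivCLM ℂ ℂ w x) + inner ℝ (derivCLM ℂ ℂ u x) (w x)) = 0 := by
    rw [integral_add (hinner _ _) (hinner _ _), hibp, neg_add_cancel]
  have hle : ∫ x, (inner ℝ (u x) (derivCLM ℂ ℂ w x) + inner ℝ (derivCLM ℂ ℂ u x) (w x))
      ≤ ∫ x, (2 * ‖derivCLM ℂ ℂ u x‖ ^ 2 - 2⁻¹ * ‖w x‖ ^ 2) := by
    refine integral_mono ((hinner _ _).add (hinner _ _))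
      (((derivCLM ℂ ℂ u).integrable_norm_sq.const_mul 2).sub
        (w.integrable_norm_sq.const_mul 2⁻¹)) fun x => ?_
    simp only [deriv_mul_id hu, hu, ← Complex.normSq_eq_norm_sq, Complex.normSq_apply,
      Complex.inner, Complex.mul_re, Complex.mul_im, Complex.conj_re, Complex.conj_im,
      Complex.add_re, Complex.add_im, Complex.ofReal_re, Complex.ofReal_im]
    generalize (w x).re = a
    generalize (w x).im = b
    generalize (derivCLM ℂ ℂ w x).re = c
    generalize (derivCLM ℂ ℂ w x).im = d
    nlinarith [sq_nonneg (a / 2 + x * c), sq_nonneg (b / 2 + x * d),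
      sq_nonneg (a + 2 * x * c), sq_nonneg (b + 2 * x * d)]
  rw [hz, integral_sub ((derivCLM ℂ ℂ u).integrable_norm_sq.const_mul 2)
    (w.integrable_norm_sq.const_mul 2⁻¹), integral_const_mul, integral_const_mul] at hle
  linarith

end Coercivity

/-- The pointwise identity `|∂ₓv|² + ¼ |Q² v|² = |∂ₓ(x w)|² + |∂ₓw|²` for `w = ⟨x⟩⁻¹ v`. -/
lemma norm_sq_deriv_add_eq {v w u : 𝓢(ℝ, ℂ)}
    (hw : ∀ y, w y = (((Real.sqrt (1 + y ^ 2))⁻¹ : ℝ) : ℂ) * v y) (hu : ∀ y, u y = y * w y)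
    (x : ℝ) :
    ‖deriv v x‖ ^ 2 + 1 / 4 * ‖Qc x ^ 2 * v x‖ ^ 2
      = ‖derivCLM ℂ ℂ u x‖ ^ 2 + ‖derivCLM ℂ ℂ w x‖ ^ 2 := by
  have hv : ∀ y, v y = ((Real.sqrt (1 + y ^ 2) : ℝ) : ℂ) * w y := fun y => by
    have : ((Real.sqrt (1 + y ^ 2) : ℝ) : ℂ) ≠ 0 := by
      exact_mod_cast (Real.sqrt_pos.2 (by positivity : 0 < 1 + y ^ 2)).ne'
    rw [hw]
    push_cast
    field_simp
  have hs : 0 < Real.sqrt (1 + x ^ 2) := Real.sqrt_pos.2 (by positivity)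
  have hs2 : Real.sqrt (1 + x ^ 2) ^ 2 = 1 + x ^ 2 := Real.sq_sqrt (by positivity)
  have hd : deriv v x = ((x / Real.sqrt (1 + x ^ 2) : ℝ) : ℂ) * w x
      + ((Real.sqrt (1 + x ^ 2) : ℝ) : ℂ) * derivCLM ℂ ℂ w x := by
    have h0 : HasDerivAt (fun y : ℝ => Real.sqrt (1 + y ^ 2)) (x / Real.sqrt (1 + x ^ 2)) x := by
      have h1 : HasDerivAt (fun y : ℝ => 1 + y ^ 2) (2 * x) x := by
        simpa using (hasDerivAt_pow 2 x).const_add 1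
      convert h1.sqrt (by positivity) using 1
      field_simp
    refine HasDerivAt.deriv ?_
    exact (h0.ofReal_comp.mul (w.hasDerivAt x)).congr_of_eventuallyEq (Eventually.of_forall hv)
  have hQ : ‖Qc x ^ 2 * v x‖ ^ 2 = 4 * ‖w x‖ ^ 2 / (1 + x ^ 2) := by
    have hn : ‖Qc x‖ ^ 2 = 2 / (1 + x ^ 2) := by
      rw [Qc, Complex.norm_real, Real.norm_eq_abs, sq_abs, Qr, div_pow, hs2,
        Real.sq_sqrt zero_le_two]
    rw [norm_mul, norm_pow, hn, hv x, norm_mul, Complex.norm_real, Real.norm_of_nonneg hs.le,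
      mul_pow, mul_pow, hs2]
    field_simp
    ring
  rw [hQ, hd, deriv_mul_id hu]
  simp only [← Complex.normSq_eq_norm_sq, Complex.normSq_apply, Complex.mul_re, Complex.mul_im,
    Complex.add_re, Complex.add_im, Complex.ofReal_re, Complex.ofReal_im]
  generalize (w x).re = a
  generalize (w x).im = b
  generalize (derivCLM ℂ ℂ w x).re = c
  generalize (derivCLM ℂ ℂ w x).im = d
  generalize Real.sqrt (1 + x ^ 2) = s at *
  have hr : x / s * s = x := div_mul_cancel₀ x hs.ne'
  have hr2 : (x / s) ^ 2 = 1 - 1 / (1 + x ^ 2) := by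
    rw [div_pow, hs2]
    field_simp
    ring
  linear_combination (a ^ 2 + b ^ 2) * hr2 + 2 * (a * c + b * d) * hr + (c ^ 2 + d ^ 2) * hs2

lemma AQ_eq {v w u : 𝓢(ℝ, ℂ)}
    (hw : ∀ y, w y = (((Real.sqrt (1 + y ^ 2))⁻¹ : ℝ) : ℂ) * v y) (hu : ∀ y, u y = y * w y)
    (x : ℝ) : AQ (fun y => v y) x = derivCLM ℂ ℂ u x - hilbert (derivCLM ℂ ℂ w) x := by
  have hB : BQ (fun y => v y) = fun x => u x - hilbert w x := by
    ext x
    have : (fun y => (((Real.sqrt (1 + y ^ 2))⁻¹ : ℝ) : ℂ) * v y) = w := funext fun y => (hw y).symm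
    simp only [BQ]
    rw [this, pvH_eq_hilbert, hu, hw]
    push_cast
    ring
  rw [AQ, hB]
  exact ((u.hasDerivAt x).sub (hasDerivAt_hilbert w x)).deriv

lemma halfDsq_eq {v w : 𝓢(ℝ, ℂ)}
    (hw : ∀ y, w y = (((Real.sqrt (1 + y ^ 2))⁻¹ : ℝ) : ℂ) * v y) :
    halfDsq (fun y => Qc y * v y)
      = 2 * (∫ x, hilbert (derivCLM ℂ ℂ w) x * conj (w x)).re := by
  have hQ : (fun y => Qc y * v y) = fun y => ((Real.sqrt 2 : ℝ) : ℂ) * w y := by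
    ext y
    rw [hw, Qc, Qr]
    push_cast
    ring
  have hd : deriv (fun y => ((Real.sqrt 2 : ℝ) : ℂ) * w y)
      = (((Real.sqrt 2 : ℝ) : ℂ) • derivCLM ℂ ℂ w : 𝓢(ℝ, ℂ)) := by
    ext y
    exact ((w.hasDerivAt y).const_mul _).deriv
  have h2 : ((Real.sqrt 2 : ℝ) : ℂ) * ((Real.sqrt 2 : ℝ) : ℂ) = ((2 : ℝ) : ℂ) := by
    rw [← Complex.ofReal_mul, Real.mul_self_sqrt zero_le_two]
  rw [hQ, halfDsq, ← Complex.re_ofReal_mul, ← integral_const_mul, hd]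
  congr 2
  ext x
  have hs : hilbert (((Real.sqrt 2 : ℝ) : ℂ) • derivCLM ℂ ℂ w : 𝓢(ℝ, ℂ)) x
      = ((Real.sqrt 2 : ℝ) : ℂ) * hilbert (derivCLM ℂ ℂ w) x := hilbert_const_mul _ _ _
  rw [pvH_eq_hilbert, hs, map_mul, Complex.conj_ofReal, ← h2]
  ring

lemma norm_sq_AQ_add_halfDsq {v w u : 𝓢(ℝ, ℂ)}
    (hw : ∀ y, w y = (((Real.sqrt (1 + y ^ 2))⁻¹ : ℝ) : ℂ) * v y) (hu : ∀ y, u y = y * w y) :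
    (∫ x, ‖AQ (fun y => v y) x‖ ^ 2) + halfDsq (fun y => Qc y * v y)
      = (∫ x, ‖derivCLM ℂ ℂ u x‖ ^ 2) + ∫ x, ‖derivCLM ℂ ℂ w x‖ ^ 2 := by
  obtain ⟨k, hk⟩ := exists_schwartz_mul_id (derivCLM ℂ ℂ w)
  have hg := integral_deriv_schwartz w
  have hsplit : (∫ x, hilbert (derivCLM ℂ ℂ w) x * conj (derivCLM ℂ ℂ u x)).re
      = (∫ x, hilbert (derivCLM ℂ ℂ w) x * conj (w x)).re := by
    have h1 : ∀ x, hilbert (derivCLM ℂ ℂ w) x * conj (derivCLM ℂ ℂ u x)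
        = hilbert (derivCLM ℂ ℂ w) x * conj (w x) + hilbert (derivCLM ℂ ℂ w) x * conj (k x) :=
      fun x => by rw [deriv_mul_id hu, hk, map_add, mul_add]
    simp_rw [h1]
    rw [integral_add (integrable_hilbert_mul_conj _ _) (integrable_hilbert_mul_conj _ _),
      Complex.add_re, re_integral_hilbert_mul_conj_mul_id hg hk, add_zero]
  simp_rw [AQ_eq hw hu]
  rw [integral_norm_sq_sub_hilbert _ hg, halfDsq_eq hw, hsplit]
  ring

lemma integrable_norm_sq_Qc_mul {v w u : 𝓢(ℝ, ℂ)}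
    (hw : ∀ y, w y = (((Real.sqrt (1 + y ^ 2))⁻¹ : ℝ) : ℂ) * v y) (hu : ∀ y, u y = y * w y) :
    Integrable fun x => 1 / 4 * ‖Qc x ^ 2 * v x‖ ^ 2 := by
  have h : ∀ x, 1 / 4 * ‖Qc x ^ 2 * v x‖ ^ 2 = ‖derivCLM ℂ ℂ u x‖ ^ 2 + ‖derivCLM ℂ ℂ w x‖ ^ 2
      - ‖derivCLM ℂ ℂ v x‖ ^ 2 := fun x => by
    rw [← norm_sq_deriv_add_eq hw hu, derivCLM_apply]
    ring
  simp_rw [h]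
  exact ((derivCLM ℂ ℂ u).integrable_norm_sq.add (derivCLM ℂ ℂ w).integrable_norm_sq).sub
    (derivCLM ℂ ℂ v).integrable_norm_sq

lemma integral_norm_sq_deriv_add {v w u : 𝓢(ℝ, ℂ)}
    (hw : ∀ y, w y = (((Real.sqrt (1 + y ^ 2))⁻¹ : ℝ) : ℂ) * v y) (hu : ∀ y, u y = y * w y) :
    (∫ x, ‖deriv (fun y => v y) x‖ ^ 2) + (1 / 4) * ∫ x, ‖Qc x ^ 2 * v x‖ ^ 2
      = (∫ x, ‖derivCLM ℂ ℂ u x‖ ^ 2) + ∫ x, ‖derivCLM ℂ ℂ w x‖ ^ 2 := by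
  have hv : Integrable fun x => ‖deriv (fun y => v y) x‖ ^ 2 :=
    (derivCLM ℂ ℂ v).integrable_norm_sq
  rw [← integral_const_mul, ← integral_add hv
    (integrable_norm_sq_Qc_mul hw hu), ← integral_add (derivCLM ℂ ℂ u).integrable_norm_sq
    (derivCLM ℂ ℂ w).integrable_norm_sq]
  congr 1
  ext x
  exact norm_sq_deriv_add_eq hw hu x

lemma integral_norm_sq_Qc_mul_le {v w u : 𝓢(ℝ, ℂ)}
    (hw : ∀ y, w y = (((Real.sqrt (1 + y ^ 2))⁻¹ : ℝ) : ℂ) * v y) (hu : ∀ y, u y = y * w y) :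
    (1 / 4) * ∫ x, ‖Qc x ^ 2 * v x‖ ^ 2 ≤ ∫ x, ‖w x‖ ^ 2 := by
  rw [← integral_const_mul]
  refine integral_mono (integrable_norm_sq_Qc_mul hw hu) w.integrable_norm_sq fun x => ?_
  have hs : 0 < Real.sqrt (1 + x ^ 2) := Real.sqrt_pos.2 (by positivity)
  have hs1 : 1 ≤ Real.sqrt (1 + x ^ 2) := Real.one_le_sqrt.2 (by nlinarith)
  have hQ : Qc x ^ 2 * v x = 2 * ((Real.sqrt (1 + x ^ 2))⁻¹ : ℝ) * w x := by
    have h2 : ((Real.sqrt 2 : ℝ) : ℂ) ^ 2 = 2 := by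
      rw [← Complex.ofReal_pow, Real.sq_sqrt zero_le_two]
      simp
    rw [hw, Qc, Qr]
    push_cast
    rw [div_pow, h2]
    ring
  have hinv : (Real.sqrt (1 + x ^ 2))⁻¹ ≤ 1 := inv_le_one_of_one_le₀ hs1
  have hn : ‖Qc x ^ 2 * v x‖ = 2 * (Real.sqrt (1 + x ^ 2))⁻¹ * ‖w x‖ := by
    rw [hQ, norm_mul, norm_mul, Complex.norm_real, Real.norm_of_nonneg (inv_nonneg.2 hs.le)]
    simp
  simp only [hn]
  have hp : (Real.sqrt (1 + x ^ 2))⁻¹ ^ 2 ≤ 1 := pow_le_one₀ (inv_nonneg.2 hs.le) hinv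
  nlinarith [mul_le_mul_of_nonneg_right hp (sq_nonneg ‖w x‖)]

lemma norm_equivalence_of_identity {a h s H : ℝ} (ha : 0 ≤ a) (hs : 0 ≤ s) (hsum : a + h = s)
    (has : a ≤ 2 * s) (hsH : s ≤ H) (hHs : H ≤ 5 * s) :
    (3 : ℝ)⁻¹ * Real.sqrt H ≤ Real.sqrt a + Real.sqrt h ∧
      Real.sqrt a + Real.sqrt h ≤ 3 * Real.sqrt H := by
  have hH : 0 ≤ H := hs.trans hsH
  have hsub : Real.sqrt s ≤ Real.sqrt a + Real.sqrt h := by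
    rw [← hsum, Real.sqrt_le_left (by positivity)]
    rcases le_total 0 h with hh | hh
    · nlinarith [Real.sq_sqrt ha, Real.sq_sqrt hh, Real.sqrt_nonneg a, Real.sqrt_nonneg h,
        mul_nonneg (Real.sqrt_nonneg a) (Real.sqrt_nonneg h)]
    · rw [Real.sqrt_eq_zero_of_nonpos hh, add_zero, Real.sq_sqrt ha]
      linarith
  have h1 : Real.sqrt H ≤ 3 * Real.sqrt s := by
    rw [Real.sqrt_le_left (by positivity), mul_pow, Real.sq_sqrt hs]
    linarith
  have h2 : Real.sqrt a ≤ 2 * Real.sqrt H := by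
    rw [Real.sqrt_le_left (by positivity), mul_pow, Real.sq_sqrt hH]
    linarith
  have h3 : Real.sqrt h ≤ Real.sqrt H := Real.sqrt_le_sqrt (by linarith)
  constructor <;> linarith

/-- Subcoercivity for `A_Q` on `𝓗̇¹`: for Schwartz `v`,
`‖A_Q v‖²_{L²} + ‖|D|^{1/2}(Qv)‖²_{L²} = ‖∂ₓv‖²_{L²} + ¼‖Q²v‖²_{L²}`, and
`‖A_Q v‖_{L²} + ‖|D|^{1/2}(Qv)‖_{L²} ∼ ‖v‖_{𝓗̇¹}` with a universal constant. -/
theorem stmt19 :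
    (∀ v : SchwartzMap ℝ ℂ,
        (∫ x : ℝ, ‖AQ (fun y => v y) x‖ ^ 2) + halfDsq (fun y => Qc y * v y)
          = (∫ x : ℝ, ‖deriv (fun y => v y) x‖ ^ 2)
              + (1 / 4) * ∫ x : ℝ, ‖Qc x ^ 2 * v x‖ ^ 2) ∧
      ∃ C : ℝ, 0 < C ∧ ∀ v : SchwartzMap ℝ ℂ,
        C⁻¹ * H1normS (fun y => v y)
            ≤ Real.sqrt (∫ x : ℝ, ‖AQ (fun y => v y) x‖ ^ 2)
              + Real.sqrt (halfDsq (fun y => Qc y * v y)) ∧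
          Real.sqrt (∫ x : ℝ, ‖AQ (fun y => v y) x‖ ^ 2)
              + Real.sqrt (halfDsq (fun y => Qc y * v y))
            ≤ C * H1normS (fun y => v y) := by
  refine ⟨fun v => ?_, 3, by norm_num, fun v => ?_⟩
  · obtain ⟨w, hw⟩ := exists_schwartz_inv_sqrt_mul v
    obtain ⟨u, hu⟩ := exists_schwartz_mul_id w
    rw [norm_sq_AQ_add_halfDsq hw hu, integral_norm_sq_deriv_add hw hu]
  · obtain ⟨w, hw⟩ := exists_schwartz_inv_sqrt_mul v
    obtain ⟨u, hu⟩ := exists_schwartz_mul_id w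
    have hid := integral_norm_sq_deriv_add hw hu
    have hHardy := integral_norm_sq_le_of_mul_id hu
    have hQ := integral_norm_sq_Qc_mul_le hw hu
    have hQ0 : 0 ≤ ∫ x, ‖Qc x ^ 2 * v x‖ ^ 2 := integral_nonneg fun x => by positivity
    have hu0 : 0 ≤ ∫ x, ‖derivCLM ℂ ℂ u x‖ ^ 2 := integral_nonneg fun x => by positivity
    have hw0 : 0 ≤ ∫ x, ‖derivCLM ℂ ℂ w x‖ ^ 2 := integral_nonneg fun x => by positivity
    have hA : ∫ x, ‖AQ (fun y => v y) x‖ ^ 2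
        ≤ 2 * ((∫ x, ‖derivCLM ℂ ℂ u x‖ ^ 2) + ∫ x, ‖derivCLM ℂ ℂ w x‖ ^ 2) := by
      simp_rw [AQ_eq hw hu]
      exact integral_norm_sq_sub_hilbert_le _ (integral_deriv_schwartz w)
    unfold H1normS
    simp_rw [← hw]
    exact norm_equivalence_of_identity (integral_nonneg fun x => by positivity)
      (add_nonneg hu0 hw0) (norm_sq_AQ_add_halfDsq hw hu) hA (by linarith) (by linarith)
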